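/- arXiv:2211.11933 — 3 statements merged into one kernel-verified Lean document; each statement's English description precedes it below -/
import Mathlib

section
/- Let p ≥ 3 be an odd integer, let m ≥ n ≥ 1 be integers, and set d := (p+n−m)/2 ∈ (1/2)ℤ. Then min{ t^s_p(m,n) : s ∈ ℤ, 1 ≤ s ≤ min(p/2, n+1) } = min{ t^s_p(m,n) : s ∈ ℤ, 1 ≤ s ≤ n+1 }, and this common value equals m + (p−1)n if d < 2; equals m + n + mn if d > n; and equals ⌈(n+1)p − 1 − d²⌉ if 2 ≤ d ≤ n. -/
open Finset TensorProduct

/-- `t^s_p(m,n) = s(m+1) + (p-s)(n+1-s) - 1`. -/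
def tsp (p m n s : ℤ) : ℤ := s * (m + 1) + (p - s) * (n + 1 - s) - 1

/-- `t_p(m,n) = min { t^s_p(m,n) : 1 ≤ s ≤ min(p/2, n+1) }`. -/
noncomputable def tmin (p m n : ℤ) : ℤ :=
  sInf {x : ℤ | ∃ s : ℤ, 1 ≤ s ∧ 2 * s ≤ p ∧ s ≤ n + 1 ∧ x = tsp p m n s}

/-- A minimizer of `tsp p m n` over `1 ≤ s ≤ n + 1` that satisfies `2 * s ≤ p` computes both
minima. -/
lemma tmin_eq_and_sInf_eq {p m n s : ℤ} (h1 : 1 ≤ s) (h2 : 2 * s ≤ p) (h3 : s ≤ n + 1)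
    (h : ∀ r : ℤ, 1 ≤ r → r ≤ n + 1 → tsp p m n s ≤ tsp p m n r) :
    tmin p m n = tsp p m n s ∧
      sInf {x : ℤ | ∃ r : ℤ, 1 ≤ r ∧ r ≤ n + 1 ∧ x = tsp p m n r} = tsp p m n s := by
  constructor
  · refine IsLeast.csInf_eq ⟨⟨s, h1, h2, h3, rfl⟩, ?_⟩
    rintro x ⟨r, hr1, -, hr3, rfl⟩
    exact h r hr1 hr3
  · refine IsLeast.csInf_eq ⟨⟨s, h1, h3, rfl⟩, ?_⟩
    rintro x ⟨r, hr1, hr3, rfl⟩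
    exact h r hr1 hr3

lemma min_tsp_of_lt_four {p m n : ℤ} (hp : 3 ≤ p) (hn : 1 ≤ n) (he : p + n - m < 4) :
    tmin p m n = m + (p - 1) * n ∧
      sInf {x : ℤ | ∃ r : ℤ, 1 ≤ r ∧ r ≤ n + 1 ∧ x = tsp p m n r} = m + (p - 1) * n := by
  have hv : tsp p m n 1 = m + (p - 1) * n := by unfold tsp; ring
  rw [← hv]
  refine tmin_eq_and_sInf_eq le_rfl (by omega) (by omega) fun r hr _ => ?_
  unfold tsp
  rcases hr.eq_or_lt with rfl | hr
  · exact le_rfl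
  · have := mul_nonneg (show 0 ≤ r - 1 by omega) (show 0 ≤ r + 1 - (p + n - m) by omega)
    linarith

lemma min_tsp_of_two_mul_lt {p m n : ℤ} (hodd : Odd p) (hnm : n ≤ m) (hn : 1 ≤ n)
    (he : 2 * n < p + n - m) :
    tmin p m n = m + n + m * n ∧
      sInf {x : ℤ | ∃ r : ℤ, 1 ≤ r ∧ r ≤ n + 1 ∧ x = tsp p m n r} = m + n + m * n := by
  have hle : ∀ r : ℤ, 1 ≤ r → r ≤ n + 1 → m + n + m * n ≤ tsp p m n r := by
    intro r _ hr
    unfold tsp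
    rcases hr.eq_or_lt with rfl | hr
    · linarith
    · have := mul_nonneg (show 0 ≤ n + 1 - r by omega) (show 0 ≤ p + n - m - (n + 1 + r) by omega)
      linarith
  obtain ⟨k, hk⟩ := hodd
  by_cases hpn : 2 * (n + 1) ≤ p
  · have hv : tsp p m n (n + 1) = m + n + m * n := by unfold tsp; ring
    rw [← hv] at hle ⊢
    exact tmin_eq_and_sInf_eq (by omega) hpn le_rfl hle
  · obtain rfl : m = n := by omega
    obtain rfl : p = 2 * m + 1 := by omega
    have hv : tsp (2 * m + 1) m m m = m + m + m * m := by unfold tsp; ring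
    rw [← hv] at hle ⊢
    exact tmin_eq_and_sInf_eq hn (by omega) (by omega) hle

lemma min_tsp_of_four_le_of_le_two_mul {p m n : ℤ} (hnm : n ≤ m)
    (h4 : 4 ≤ p + n - m) (he : p + n - m ≤ 2 * n) :
    tmin p m n = ⌈((n : ℚ) + 1) * p - 1 - (((p : ℚ) + n - m) / 2) ^ 2⌉ ∧
      sInf {x : ℤ | ∃ r : ℤ, 1 ≤ r ∧ r ≤ n + 1 ∧ x = tsp p m n r} =
        ⌈((n : ℚ) + 1) * p - 1 - (((p : ℚ) + n - m) / 2) ^ 2⌉ := by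
  obtain ⟨s, hs⟩ : ∃ s : ℤ, p + n - m = 2 * s ∨ p + n - m = 2 * s + 1 :=
    ⟨(p + n - m) / 2, by omega⟩
  have hv : ⌈((n : ℚ) + 1) * p - 1 - (((p : ℚ) + n - m) / 2) ^ 2⌉ = tsp p m n s := by
    rw [Int.ceil_eq_iff]
    unfold tsp
    push_cast
    rcases hs with hs | hs
    · obtain rfl : m = p + n - 2 * s := by omega
      push_cast
      constructor <;> linarith
    · obtain rfl : m = p + n - (2 * s + 1) := by omega
      push_cast
      constructor <;> linarith
  rw [hv]
  refine tmin_eq_and_sInf_eq (by omega) (by omega) (by omega) fun r _ _ => ?_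
  unfold tsp
  rcases hs with hs | hs
  · obtain rfl : m = p + n - 2 * s := by omega
    linarith [sq_nonneg (r - s)]
  · obtain rfl : m = p + n - (2 * s + 1) := by omega
    have : 0 ≤ (r - s) * (r - s - 1) := by
      rcases le_or_gt r s with h | h
      · exact mul_nonneg_of_nonpos_of_nonpos (by omega) (by omega)
      · exact mul_nonneg (by omega) (by omega)
    linarith

/-- Equivalence of the two formulas for `t_p(m,n)`: the minimum over `1 ≤ s ≤ min(p/2, n+1)`
equals the minimum over `1 ≤ s ≤ n+1`, and is given by the case-by-case formula in `d`. -/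
theorem stmt2 (p m n : ℤ) (hp : 3 ≤ p) (hodd : Odd p) (hnm : n ≤ m) (hn : 1 ≤ n)
    (d : ℚ) (hd : d = ((p : ℚ) + n - m) / 2) :
    tmin p m n = sInf {x : ℤ | ∃ s : ℤ, 1 ≤ s ∧ s ≤ n + 1 ∧ x = tsp p m n s} ∧
    (d < 2 → tmin p m n = m + (p - 1) * n) ∧
    ((n : ℚ) < d → tmin p m n = m + n + m * n) ∧
    (2 ≤ d → d ≤ n → tmin p m n = ⌈((n : ℚ) + 1) * p - 1 - d ^ 2⌉) := by
  have h2 : d < 2 ↔ p + n - m < 4 := by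
    rw [hd, div_lt_iff₀ two_pos]
    norm_num
    exact_mod_cast Iff.rfl
  have hn' : (n : ℚ) < d ↔ 2 * n < p + n - m := by
    rw [hd, lt_div_iff₀ two_pos, mul_comm]
    exact_mod_cast Iff.rfl
  refine ⟨?_, fun h => (min_tsp_of_lt_four hp hn (h2.1 h)).1,
    fun h => (min_tsp_of_two_mul_lt hodd hnm hn (hn'.1 h)).1, fun h h' => ?_⟩
  · rcases lt_or_ge (p + n - m) 4 with h | h
    · obtain ⟨ha, hb⟩ := min_tsp_of_lt_four hp hn h
      exact ha.trans hb.symm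
    · rcases lt_or_ge (2 * n) (p + n - m) with h' | h'
      · obtain ⟨ha, hb⟩ := min_tsp_of_two_mul_lt hodd hnm hn h'
        exact ha.trans hb.symm
      · obtain ⟨ha, hb⟩ := min_tsp_of_four_le_of_le_two_mul hnm h h'
        exact ha.trans hb.symm
  · rw [← not_lt, h2, not_lt] at h
    rw [← not_lt, hn', not_lt] at h'
    rw [hd]
    exact (min_tsp_of_four_le_of_le_two_mul hnm h h').1
end

section
/- Let k be a field, let A be a finite-dimensional k-algebra which is self-injective (i.e. A is injective as a left A-module; for example A = k[G] for a finite group G), and let M be a finite-dimensional A-module. Then M is a faithful A-module if and only if every indecomposable projective A-module is isomorphic to a direct summand of M. (Here a nonzero finitely generated A-module P is indecomposable if it is not isomorphic to a direct sum of two nonzero A-modules.) -/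
/-- Fitting's lemma: an indecomposable module of finite length has a local endomorphism ring. -/
theorem isLocalRing_end_of_indecomposable {R P : Type*} [Ring R] [AddCommGroup P] [Module R P]
    [Nontrivial P] [IsNoetherian R P] [IsArtinian R P]
    (h : ∀ N₁ N₂ : Submodule R P, IsCompl N₁ N₂ → N₁ = ⊥ ∨ N₂ = ⊥) :
    IsLocalRing (Module.End R P) where
  isUnit_or_isUnit_of_add_one {a b} hab := by
    obtain ⟨n, hn⟩ := Filter.eventually_atTop.mp a.eventually_isCompl_ker_pow_range_pow
    have hc := hn (n + 1) n.le_succ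
    rcases h _ _ hc with hk | hr
    · left
      rw [hk] at hc
      have hu : IsUnit (a ^ (n + 1)) := (Module.End.isUnit_iff _).mpr
        ⟨LinearMap.ker_eq_bot.mp hk, LinearMap.range_eq_top.mp (eq_top_of_bot_isCompl hc)⟩
      exact (isUnit_pow_iff n.succ_ne_zero).mp hu
    · right
      have hnil : IsNilpotent a := ⟨n + 1, LinearMap.range_eq_bot.mp hr⟩
      rw [eq_sub_of_add_eq' hab]
      exact hnil.isUnit_one_sub

/-- If the composite `P → M → P` is invertible, then `P` is isomorphic to a direct summand
of `M`. -/
theorem exists_isCompl_equiv_of_isUnit_comp {R P M : Type*} [Ring R] [AddCommGroup P] [Module R P]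
    [AddCommGroup M] [Module R M] (i : P →ₗ[R] M) (r : M →ₗ[R] P)
    (h : IsUnit (r ∘ₗ i : Module.End R P)) :
    ∃ N N' : Submodule R M, IsCompl N N' ∧ Nonempty (P ≃ₗ[R] ↥N) := by
  have hb : Function.Bijective (r ∘ i) := (Module.End.isUnit_iff _).mp h
  refine ⟨LinearMap.range i, LinearMap.ker r, ⟨?_, ?_⟩,
    ⟨LinearEquiv.ofInjective i hb.injective.of_comp⟩⟩
  · rw [Submodule.disjoint_def]
    rintro _ ⟨x, rfl⟩ hx
    have hx0 : x = 0 := hb.injective (by simpa using hx)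
    rw [hx0, map_zero]
  · rw [codisjoint_iff, eq_top_iff]
    intro m _
    obtain ⟨x, hx⟩ := hb.surjective (r m)
    refine Submodule.mem_sup.mpr ⟨i x, ⟨x, rfl⟩, m - i x, ?_, add_sub_cancel _ _⟩
    rw [LinearMap.mem_ker, map_sub, sub_eq_zero]
    exact hx.symm

/-- A finitely generated projective module over a self-injective ring is injective. -/
theorem injective_of_finite_projective {R P : Type} [Ring R] [Module.Injective R R]
    [AddCommGroup P] [Module R P] [Module.Finite R P] [Module.Projective R P] :
    Module.Injective R P := by
  obtain ⟨n, f, g, -, -, hfg⟩ := Module.Finite.exists_comp_eq_id_of_projective R P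
  refine ⟨fun X Y _ _ _ _ j hj u ↦ ?_⟩
  obtain ⟨v, hv⟩ := Module.Injective.out j hj (g ∘ₗ u)
  exact ⟨f ∘ₗ v, fun x ↦ by simpa [hv] using LinearMap.congr_fun hfg (u x)⟩

/-- An indecomposable injective module of finite length that embeds in a finite power of `M` is
isomorphic to a direct summand of `M`. -/
theorem exists_isCompl_equiv_of_injective_pi {R P M : Type} {ι : Type} [Finite ι] [Ring R]
    [AddCommGroup P] [Module R P] [AddCommGroup M] [Module R M]
    [Nontrivial P] [IsNoetherian R P] [IsArtinian R P] [Module.Injective R P]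
    (h : ∀ N₁ N₂ : Submodule R P, IsCompl N₁ N₂ → N₁ = ⊥ ∨ N₂ = ⊥)
    (e : P →ₗ[R] ι → M) (he : Function.Injective e) :
    ∃ N N' : Submodule R M, IsCompl N N' ∧ Nonempty (P ≃ₗ[R] ↥N) := by
  classical
  cases nonempty_fintype ι
  have := isLocalRing_end_of_indecomposable h
  obtain ⟨r, hr⟩ := Module.Injective.out e he (LinearMap.id : P →ₗ[R] P)
  have hsum : ∑ i, (r ∘ₗ LinearMap.single R (fun _ ↦ M) i) ∘ₗ (LinearMap.proj i ∘ₗ e) =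
      (1 : Module.End R P) := by
    ext x
    simp only [LinearMap.sum_apply, LinearMap.comp_apply, LinearMap.proj_apply, ← map_sum,
      LinearMap.coe_single, Finset.univ_sum_single, hr]
    rfl
  obtain ⟨i, -, hi⟩ := IsLocalRing.exists_of_isUnit_sum (hsum ▸ isUnit_one)
  exact exists_isCompl_equiv_of_isUnit_comp _ _ hi

/-- If a ring element kills every indecomposable projective submodule of an Artinian module,
then it kills every projective submodule. -/
theorem smul_eq_zero_of_projective_submodule {R Q : Type*} [Ring R] [AddCommGroup Q] [Module R Q]
    [IsArtinian R Q] (a : R)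
    (h : ∀ N : Submodule R Q, Module.Projective R N → N ≠ ⊥ →
      (∀ N₁ N₂ : Submodule R N, IsCompl N₁ N₂ → N₁ = ⊥ ∨ N₂ = ⊥) → ∀ x : N, a • x = 0)
    (N : Submodule R Q) (hN : Module.Projective R N) (x : N) : a • x = 0 := by
  induction N using WellFoundedLT.induction with
  | ind N ih =>
  by_cases hbot : N = ⊥
  · subst hbot
    exact Subsingleton.elim _ _
  by_cases hind : ∀ N₁ N₂ : Submodule R N, IsCompl N₁ N₂ → N₁ = ⊥ ∨ N₂ = ⊥
  · exact h N hN hbot hind x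
  push Not at hind
  obtain ⟨N₁, N₂, hc, h₁, h₂⟩ := hind
  have key : ∀ K L : Submodule R N, IsCompl K L → L ≠ ⊥ → ∀ y ∈ K, a • y = 0 := by
    intro K L hKL hL y hy
    have hK : Module.Projective R K :=
      .of_split K.subtype (K.projectionOnto L hKL) (by ext; simp)
    have hlt : K.map N.subtype < N := by
      refine lt_of_le_of_ne (Submodule.map_subtype_le _ _) fun heq ↦ hL ?_
      have hK' : K = ⊤ := by
        rw [eq_top_iff]
        intro z _
        have hz : (z : Q) ∈ K.map N.subtype := heq.ge z.2
        simpa using hz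
      subst hK'
      exact eq_bot_of_top_isCompl hKL
    have hp : Module.Projective R (K.map N.subtype) :=
      .of_equiv (Submodule.equivMapOfInjective N.subtype N.injective_subtype K)
    have hz := congrArg Subtype.val
      (ih _ hlt hp ⟨N.subtype y, Submodule.mem_map_of_mem hy⟩)
    exact Subtype.ext hz
  obtain ⟨y, hy, z, hz, rfl⟩ := Submodule.mem_sup.mp
    (hc.sup_eq_top ▸ Submodule.mem_top : x ∈ N₁ ⊔ N₂)
  rw [smul_add, key _ _ hc h₂ y hy, key _ _ hc.symm h₁ z hz, add_zero]


/-- Lemma `LemDim(ii)` of the paper: over a self-injective finite-dimensional algebra `A`,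
a finite-dimensional module `M` is faithful iff every indecomposable projective `A`-module
is isomorphic to a direct summand of `M`. -/
theorem stmt7 (k : Type) [Field k] (A : Type) [Ring A] [Algebra k A]
    [FiniteDimensional k A] (hA : Module.Injective A A)
    (M : Type) [AddCommGroup M] [Module A M] [Module k M] [IsScalarTower k A M]
    [FiniteDimensional k M] :
    FaithfulSMul A M ↔
      ∀ (P : Type) [AddCommGroup P] [Module A P], Module.Finite A P →
        Module.Projective A P →
        ((∃ x : P, x ≠ 0) ∧
          ∀ N₁ N₂ : Submodule A P, IsCompl N₁ N₂ → N₁ = ⊥ ∨ N₂ = ⊥) →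
        ∃ N N' : Submodule A M, IsCompl N N' ∧ Nonempty (P ≃ₗ[A] ↥N) := by
  have : IsArtinianRing A := isArtinian_of_tower k inferInstance
  have : IsNoetherianRing A := isNoetherian_of_tower k inferInstance
  constructor
  · intro hM P _ _ hfin hproj ⟨⟨x, hx⟩, hind⟩
    have : Nontrivial P := ⟨x, 0, hx⟩
    have : Module.Injective A P := injective_of_finite_projective
    obtain ⟨n, f, g, -, hg, -⟩ := Module.Finite.exists_comp_eq_id_of_projective A P
    let b := Module.finBasis k M
    let e : (Fin n → A) →ₗ[A] Fin n × Fin (Module.finrank k M) → M :=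
      LinearMap.pi fun p ↦ LinearMap.toSpanSingleton A M (b p.2) ∘ₗ LinearMap.proj p.1
    have he : Function.Injective e := by
      rw [injective_iff_map_eq_zero]
      intro v hv
      ext i
      refine hM.eq_of_smul_eq_smul fun m ↦ ?_
      have hb : Module.toModuleEnd k M (v i) = 0 :=
        b.ext fun j ↦ by simpa [e] using congrFun hv (i, j)
      simpa using LinearMap.congr_fun hb m
    exact exists_isCompl_equiv_of_injective_pi hind (e ∘ₗ g) (he.comp hg)
  · intro h
    have hann : ∀ a : A, (∀ m : M, a • m = 0) → a = 0 := by
      intro a ha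
      have hz := smul_eq_zero_of_projective_submodule (Q := A) a
        (fun N hN hbot hind x ↦ by
          obtain ⟨y, hy, hy0⟩ := N.ne_bot_iff.mp hbot
          obtain ⟨K, -, -, ⟨e⟩⟩ := h N inferInstance hN
            ⟨⟨⟨y, hy⟩, fun h0 ↦ hy0 (congrArg Subtype.val h0)⟩, hind⟩
          apply e.injective
          rw [map_smul, map_zero]
          exact Subtype.ext (ha _))
        ⊤ (.of_equiv Submodule.topEquiv.symm) ⟨1, trivial⟩
      simpa using congrArg Subtype.val hz
    refine ⟨fun {a₁ a₂} hab ↦ sub_eq_zero.mp (hann _ fun m ↦ ?_)⟩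
    rw [sub_smul, hab, sub_self]
end

section
/- Let f : A → B be a homomorphism of finitely generated free abelian groups, let p be a prime, and let k be a field of characteristic p. Then: (i) dim_k (k ⊗_ℤ I_p(f)) = rank A − rank(ker f); (ii) the induced k-linear map k ⊗_ℤ I_p(f) → k ⊗_ℤ B is injective; (iii) if A and B are rings and f is a ring homomorphism, then I_p(f) is a subring of B. -/
open Finset TensorProduct

/-- The subring `ℤ[1/p]` of `ℚ`. -/
def Rloc (p : ℕ) : Subring ℚ := Subring.closure {((p : ℚ))⁻¹}

/-- `I_p(f)`: the subgroup of elements `b` of `B` with `1 ⊗ b` in the image of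
`f[1/p] : ℤ[1/p] ⊗ A → ℤ[1/p] ⊗ B`. -/
noncomputable def Ip (p : ℕ) {A B : Type} [AddCommGroup A] [AddCommGroup B]
    (f : A →ₗ[ℤ] B) : AddSubgroup B where
  carrier := {b | ∃ y, LinearMap.baseChange (Rloc p) f y = (1 : Rloc p) ⊗ₜ[ℤ] b}
  zero_mem' := ⟨0, by simp [TensorProduct.tmul_zero]⟩
  add_mem' := by
    rintro a b ⟨y, hy⟩ ⟨z, hz⟩
    exact ⟨y + z, by simp [map_add, hy, hz, TensorProduct.tmul_add]⟩
  neg_mem' := by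
    rintro a ⟨y, hy⟩
    exact ⟨-y, by simp [map_neg, hy, TensorProduct.tmul_neg]⟩

theorem exists_pow_smul_mem_range {p : ℕ} (hp : p.Prime) (x : Rloc p) :
    ∃ (n : ℕ) (m : ℤ), p ^ n • x = m • (1 : Rloc p) := by
  have hp0 : (p : ℚ) ≠ 0 := mod_cast hp.ne_zero
  suffices h : ∃ (n : ℕ) (m : ℤ), (p : ℚ) ^ n * x = m by
    obtain ⟨n, m, h⟩ := h
    exact ⟨n, m, Subtype.ext (by simpa using h)⟩
  obtain ⟨x, hx⟩ := x
  induction hx using Subring.closure_induction with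
  | mem x hx =>
    obtain rfl := Set.mem_singleton_iff.1 hx
    exact ⟨1, 1, by simp [hp0]⟩
  | zero => exact ⟨0, 0, by simp⟩
  | one => exact ⟨0, 1, by simp⟩
  | add x y _ _ hx hy =>
    obtain ⟨n, m, h⟩ := hx
    obtain ⟨n', m', h'⟩ := hy
    refine ⟨n + n', p ^ n' * m + p ^ n * m', ?_⟩
    push_cast
    rw [← h, ← h']
    ring
  | neg x _ hx =>
    obtain ⟨n, m, h⟩ := hx
    exact ⟨n, -m, by simpa using h⟩
  | mul x y _ _ hx hy =>
    obtain ⟨n, m, h⟩ := hx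
    obtain ⟨n', m', h'⟩ := hy
    refine ⟨n + n', m * m', ?_⟩
    push_cast
    rw [← h, ← h']
    ring

theorem exists_pow_smul_eq_one_tmul {p : ℕ} (hp : p.Prime) {A : Type} [AddCommGroup A]
    (y : Rloc p ⊗[ℤ] A) : ∃ (n : ℕ) (a : A), p ^ n • y = (1 : Rloc p) ⊗ₜ[ℤ] a := by
  induction y with
  | zero => exact ⟨0, 0, by simp⟩
  | tmul x a =>
    obtain ⟨n, m, h⟩ := exists_pow_smul_mem_range hp x
    exact ⟨n, m • a, by rw [smul_tmul', h, smul_tmul]⟩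
  | add y z hy hz =>
    obtain ⟨n, a, h⟩ := hy
    obtain ⟨n', a', h'⟩ := hz
    refine ⟨n + n', p ^ n' • a + p ^ n • a', ?_⟩
    rw [tmul_add, tmul_smul, tmul_smul, ← h, ← h', smul_add, pow_add]
    simp only [mul_smul, smul_comm (p ^ n)]

theorem one_tmul_injective (R B : Type) [CommRing R] [CharZero R] [AddCommGroup B]
    [Module.Free ℤ B] : Function.Injective fun b : B => (1 : R) ⊗ₜ[ℤ] b := by
  intro x y h
  refine (TensorProduct.lid ℤ B).symm.injective (Module.Flat.rTensor_preserves_injective_linearMap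
    (M := B) (Algebra.linearMap ℤ R) Int.cast_injective ?_)
  simpa using h

theorem mem_Ip_iff {p : ℕ} (hp : p.Prime) {A B : Type} [AddCommGroup A] [AddCommGroup B]
    [Module.Free ℤ B] (f : A →ₗ[ℤ] B) (b : B) :
    b ∈ Ip p f ↔ ∃ (n : ℕ) (a : A), f a = p ^ n • b := by
  constructor
  · rintro ⟨y, hy⟩
    obtain ⟨n, a, h⟩ := exists_pow_smul_eq_one_tmul hp y
    refine ⟨n, a, one_tmul_injective (Rloc p) B ?_⟩
    change (1 : Rloc p) ⊗ₜ[ℤ] f a = (1 : Rloc p) ⊗ₜ[ℤ] (p ^ n • b)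
    rw [tmul_smul, ← hy, ← map_nsmul, h, LinearMap.baseChange_tmul]
  · rintro ⟨n, a, h⟩
    have hp0 : (p : ℚ) ≠ 0 := mod_cast hp.ne_zero
    let u : Rloc p := ⟨(p : ℚ)⁻¹, Subring.subset_closure rfl⟩
    have hu : p ^ n • u ^ n = 1 := by
      rw [nsmul_eq_mul, Nat.cast_pow, ← mul_pow]
      exact (congrArg (· ^ n) (Subtype.ext (mul_inv_cancel₀ hp0))).trans (one_pow n)
    exact ⟨(u ^ n) ⊗ₜ[ℤ] a, by rw [LinearMap.baseChange_tmul, h, tmul_smul, smul_tmul', hu]⟩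

theorem mem_Ip_of_prime_smul_mem {p : ℕ} (hp : p.Prime) {A B : Type} [AddCommGroup A]
    [AddCommGroup B] [Module.Free ℤ B] (f : A →ₗ[ℤ] B) {b : B} (h : p • b ∈ Ip p f) :
    b ∈ Ip p f := by
  rw [mem_Ip_iff hp] at h ⊢
  obtain ⟨n, a, h⟩ := h
  exact ⟨n + 1, a, by rw [h, pow_succ, mul_smul]⟩

theorem finrank_Ip {p : ℕ} (hp : p.Prime) {A B : Type} [AddCommGroup A] [AddCommGroup B]
    [Module.Finite ℤ A] [Module.Free ℤ B] [Module.Finite ℤ B] (f : A →ₗ[ℤ] B) :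
    Module.finrank ℤ (Ip p f) = Module.finrank ℤ A - Module.finrank ℤ (LinearMap.ker f) := by
  let N : Submodule ℤ B := AddSubgroup.toIntSubmodule (Ip p f)
  have hle : LinearMap.range f ≤ N := by
    rintro _ ⟨a, rfl⟩
    exact (mem_Ip_iff hp f _).2 ⟨0, a, by simp⟩
  have htors : Module.finrank ℤ (N ⧸ (LinearMap.range f).comap N.subtype) = 0 := by
    rw [Module.finrank_eq_zero_iff_isTorsion]
    intro x
    obtain ⟨⟨b, hb⟩, rfl⟩ := Submodule.Quotient.mk_surjective _ x
    obtain ⟨n, a, h⟩ := (mem_Ip_iff hp f b).1 hb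
    refine ⟨⟨(p : ℤ) ^ n, mem_nonZeroDivisors_of_ne_zero
      (pow_ne_zero _ (mod_cast hp.ne_zero))⟩, ?_⟩
    change (p : ℤ) ^ n • ((LinearMap.range f).comap N.subtype).mkQ ⟨b, hb⟩ = 0
    rw [← map_smul, Submodule.mkQ_apply, Submodule.Quotient.mk_eq_zero]
    refine ⟨a, h.trans ?_⟩
    rw [← natCast_zsmul]
    simp
  have hN := Submodule.finrank_quotient_add_finrank ((LinearMap.range f).comap N.subtype)
  rw [htors, zero_add, (Submodule.comapSubtypeEquivOfLe hle).finrank_eq] at hN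
  have hA := Submodule.finrank_quotient_add_finrank (LinearMap.ker f)
  rw [f.quotKerEquivRange.finrank_eq] at hA
  have hI : Module.finrank ℤ (Ip p f) = Module.finrank ℤ N := rfl
  omega

theorem baseChange_subtype_injective_of_pure {p : ℕ} (hp : p.Prime) (k : Type) [Field k]
    [CharP k p] {B : Type} [AddCommGroup B] [Module.Free ℤ B] [Module.Finite ℤ B]
    (I : AddSubgroup B) (hI : ∀ b, p • b ∈ I → b ∈ I) :
    Function.Injective (LinearMap.baseChange k I.subtype.toIntLinearMap) := by
  obtain ⟨n, s⟩ := Submodule.smithNormalForm (Module.Free.chooseBasis ℤ B)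
    (AddSubgroup.toIntSubmodule I)
  have ha (i : Fin n) : (s.a i : k) ≠ 0 := by
    intro h0
    obtain ⟨c, hc⟩ := (CharP.intCast_eq_zero_iff k p _).1 h0
    have hs := s.snf i
    have hmem : c • s.bM (s.f i) ∈ I := by
      apply hI
      rw [← natCast_zsmul, smul_smul, ← hc, ← hs]
      exact (s.bN i).2
    have hdiv : s.bN i = (p : ℤ) • (⟨c • s.bM (s.f i), hmem⟩ : AddSubgroup.toIntSubmodule I) :=
      Subtype.ext (by rw [hs, hc, mul_smul]; rfl)
    have h1 := congrArg (fun x => s.bN.repr x i) hdiv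
    simp only [Module.Basis.repr_self, Finsupp.single_eq_same, map_smul, Finsupp.smul_apply,
      smul_eq_mul] at h1
    exact hp.one_lt.ne' (mod_cast Int.eq_one_of_mul_eq_one_right (by positivity) h1.symm)
  let e : AddSubgroup.toIntSubmodule I ≃ₗ[ℤ] I := (AddEquiv.refl I).toIntLinearEquiv
  let b := (s.bN.map e).baseChange k
  have hb : LinearMap.baseChange k I.subtype.toIntLinearMap =
      b.constr k fun i => (s.a i : k) • (s.bM.baseChange k) (s.f i) := by
    refine b.ext fun i => ?_
    rw [Module.Basis.constr_basis, Module.Basis.baseChange_apply, Module.Basis.baseChange_apply,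
      LinearMap.baseChange_tmul]
    change (1 : k) ⊗ₜ[ℤ] ((s.bN i : B)) = _
    rw [s.snf, ← smul_tmul, smul_tmul', zsmul_one, smul_eq_mul, mul_one]
  rw [hb]
  apply Module.Basis.injective_constr_of_linearIndependent
  exact ((s.bM.baseChange k).linearIndependent.comp _ s.f.injective).units_smul
    fun i => Units.mk0 _ (ha i)

theorem exists_subring_coe_eq_Ip (p : ℕ) {A B : Type} [Ring A] [Ring B] (g : A →+* B) :
    ∃ S : Subring B, (S : Set B) = (Ip p g.toAddMonoidHom.toIntLinearMap : Set B) := by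
  let F := Algebra.TensorProduct.map (AlgHom.id ℤ (Rloc p)) g.toIntAlgHom
  let ι : B →ₐ[ℤ] Rloc p ⊗[ℤ] B := Algebra.TensorProduct.includeRight
  exact ⟨F.toRingHom.range.comap ι.toRingHom, rfl⟩

/-- Lemma `LemApf` of the paper: (i) `dim_k (k ⊗ I_p(f)) = rank A − rank ker f`;
(ii) the induced map `k ⊗ I_p(f) → k ⊗ B` is injective;
(iii) if `f` is a ring homomorphism then `I_p(f)` is a subring of `B`. -/
theorem stmt9 (p : ℕ) (hp : p.Prime) (k : Type) [Field k] [CharP k p]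
    (A B : Type) [AddCommGroup A] [AddCommGroup B]
    [Module.Free ℤ A] [Module.Finite ℤ A] [Module.Free ℤ B] [Module.Finite ℤ B]
    (f : A →ₗ[ℤ] B) :
    Module.finrank k (k ⊗[ℤ] ↥(Ip p f))
        = Module.finrank ℤ A - Module.finrank ℤ (LinearMap.ker f) ∧
    Function.Injective
      (LinearMap.baseChange k ((AddSubgroup.subtype (Ip p f)).toIntLinearMap)) ∧
    (∀ (A' B' : Type) [Ring A'] [Ring B'], ∀ g : A' →+* B',
      ∃ S : Subring B',
        (S : Set B') = (Ip p g.toAddMonoidHom.toIntLinearMap : Set B')) := by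
  have : Module.Free ℤ (Ip p f) :=
    inferInstanceAs (Module.Free ℤ (AddSubgroup.toIntSubmodule (Ip p f)))
  refine ⟨?_, ?_, fun A' B' _ _ g => exists_subring_coe_eq_Ip p g⟩
  · rw [Module.finrank_baseChange, finrank_Ip hp]
  · exact baseChange_subtype_injective_of_pure hp k _ fun _ => mem_Ip_of_prime_smul_mem hp f
end
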